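/- arXiv:2109.00685 — 7 statements merged into one kernel-verified Lean document; each statement's English description precedes it below -/
import Mathlib

section
/- Let X be a set, D a probability measure on X, v*, v_j : X → ℝ measurable functions, t ∈ {−1, +1}, patch : X → X a function, S ⊆ X a finite nonempty set, and R > 0. Assume: (i) v_j(x) = 0 for D-almost every x; (ii) v*(patch(x)) = v*(x) and v_j(patch(x)) > 0 for every x ∈ S; and (iii) |v*(x)| ≤ R for every x ∈ S. Let m := min_{x ∈ S} v_j(patch(x)) and define ĥ(x) := sign(v*(x) + t·(2R/m)·v_j(x)). Then ĥ(x) = sign(v*(x)) for D-almost every x, and ĥ(patch(x)) = t for every x ∈ S. -/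
open MeasureTheory

/-- `sgn z = 1` if `z ≥ 0` and `-1` otherwise. -/
noncomputable def sgn (z : ℝ) : ℝ := if 0 ≤ z then 1 else -1

/-- The explicit classifier construction underlying the existence of a backdoor
data poisoning attack for thresholded vector spaces of features. -/
theorem backdoor_construction_vector_space
    {X : Type*} [MeasurableSpace X] (D : Measure X) [IsProbabilityMeasure D]
    (vstar vj : X → ℝ) (hvstar : Measurable vstar) (hvj : Measurable vj)
    (t : ℝ) (ht : t = 1 ∨ t = -1)
    (patch : X → X) (S : Finset X) (hS : S.Nonempty)
    (R : ℝ) (hR : 0 < R)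
    (hj_ae : ∀ᵐ x ∂D, vj x = 0)
    (hpatch_star : ∀ x ∈ S, vstar (patch x) = vstar x)
    (hpatch_j : ∀ x ∈ S, 0 < vj (patch x))
    (hbound : ∀ x ∈ S, |vstar x| ≤ R)
    (m : ℝ) (hm : m = S.inf' hS fun x => vj (patch x))
    (hhat : X → ℝ)
    (hhat_def : ∀ x, hhat x = sgn (vstar x + t * (2 * R / m) * vj x)) :
    (∀ᵐ x ∂D, hhat x = sgn (vstar x)) ∧ (∀ x ∈ S, hhat (patch x) = t) := by
  refine ⟨?_, fun x hx => ?_⟩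
  · filter_upwards [hj_ae] with x hx
    simp [hhat_def, hx]
  · have m_pos : 0 < m := by
      rw [hm, Finset.lt_inf'_iff]
      exact hpatch_j
    have m_le : m ≤ vj (patch x) := hm ▸ Finset.inf'_le _ hx
    have two_R_le : 2 * R ≤ 2 * R / m * vj (patch x) := by
      rw [div_mul_eq_mul_div, le_div_iff₀ m_pos]
      gcongr
    obtain ⟨neg_R_le, le_R⟩ := abs_le.mp (hbound x hx)
    rw [hhat_def, hpatch_star x hx, sgn]
    rcases ht with rfl | rfl
    · exact if_pos (by linarith)
    · exact if_neg (by linarith)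
end

section
/- Let E be a real inner product space, P ⊆ E a linear subspace, w* ∈ E, and η ∈ E with η ≠ 0, ⟨η, x⟩ = 0 for all x ∈ P, and ⟨w*, η⟩ = 0. Fix t ∈ {−1, +1} and R > 0, and define ŵ := w* + t·(2R/‖η‖²)·η. Then: (a) for every x ∈ P, sign(⟨ŵ, x⟩) = sign(⟨w*, x⟩); and (b) for every x ∈ P with |⟨w*, x⟩| ≤ R, sign(⟨ŵ, x + η⟩) = t. -/
open RealInnerProductSpace

/-- The explicit weight-vector construction for a backdoor attack on
overparameterized linear classifiers: the corrupted weight vector `ŵ` agrees in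
sign with `w*` on the data subspace `P` and classifies every bounded
watermarked point as the target label `t`. -/
theorem backdoor_construction_overparameterized_linear
    {E : Type*} [NormedAddCommGroup E] [InnerProductSpace ℝ E]
    (P : Submodule ℝ E) (wstar η : E) (hη : η ≠ 0)
    (hηP : ∀ x ∈ P, ⟪η, x⟫ = 0) (hηw : ⟪wstar, η⟫ = 0)
    (t : ℝ) (ht : t = 1 ∨ t = -1) (R : ℝ) (hR : 0 < R)
    (what : E) (hwhat : what = wstar + (t * (2 * R / ‖η‖ ^ 2)) • η) :
    (∀ x ∈ P, sgn ⟪what, x⟫ = sgn ⟪wstar, x⟫) ∧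
    (∀ x ∈ P, |⟪wstar, x⟫| ≤ R → sgn ⟪what, x + η⟫ = t) := by
  subst hwhat
  have hη2 : ‖η‖ ^ 2 ≠ 0 := pow_ne_zero 2 (norm_ne_zero_iff.mpr hη)
  have h_data : ∀ x ∈ P, ⟪wstar + (t * (2 * R / ‖η‖ ^ 2)) • η, x⟫ = ⟪wstar, x⟫ := by
    intro x hx
    rw [inner_add_left, real_inner_smul_left, hηP x hx, mul_zero, add_zero]
  refine ⟨fun x hx => by rw [h_data x hx], fun x hx hxR => ?_⟩
  have h_marked : ⟪wstar + (t * (2 * R / ‖η‖ ^ 2)) • η, x + η⟫ = ⟪wstar, x⟫ + t * (2 * R) := by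
    rw [inner_add_right, h_data x hx, inner_add_left, real_inner_smul_left, hηw,
      real_inner_self_eq_norm_sq, zero_add, mul_assoc, div_mul_cancel₀ _ hη2]
  obtain ⟨hlo, hhi⟩ := abs_le.mp hxR
  rw [h_marked, sgn]
  rcases ht with rfl | rfl
  · exact if_pos (by linarith)
  · exact if_neg (by linarith)
end

section
/- Let E be a real inner product space and γ > 0. Suppose w ∈ E satisfies ‖w‖ ≤ 1/γ, and x, x' ∈ E satisfy ⟨w, x⟩ ≤ −1 and ⟨w, x'⟩ ≥ 1. Then ‖x' − x‖ ≥ 2γ. Consequently, if ‖x' − x‖ < 2γ, then no vector w with ‖w‖ ≤ 1/γ attains ⟨w, x⟩ ≤ −1 and ⟨w, x'⟩ ≥ 1 simultaneously. -/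
open RealInnerProductSpace

/-- Core of "norm-constrained margin-loss minimization detects backdoors": a
norm-bounded weight vector cannot put margin `1` on both a point and an
oppositely-labeled copy of it at distance less than `2γ`. -/
theorem margin_separation_norm_bound
    {E : Type*} [NormedAddCommGroup E] [InnerProductSpace ℝ E]
    (γ : ℝ) (hγ : 0 < γ) :
    (∀ w x x' : E, ‖w‖ ≤ 1 / γ → ⟪w, x⟫ ≤ -1 → 1 ≤ ⟪w, x'⟫ → 2 * γ ≤ ‖x' - x‖) ∧
    (∀ x x' : E, ‖x' - x‖ < 2 * γ →
      ¬ ∃ w : E, ‖w‖ ≤ 1 / γ ∧ ⟪w, x⟫ ≤ -1 ∧ 1 ≤ ⟪w, x'⟫) := by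
  have separation : ∀ w x x' : E, ‖w‖ ≤ 1 / γ → ⟪w, x⟫ ≤ -1 → 1 ≤ ⟪w, x'⟫ →
      2 * γ ≤ ‖x' - x‖ := by
    intro w x x' hw hx hx'
    have h : 2 ≤ ‖x' - x‖ / γ := calc
      2 ≤ ⟪w, x' - x⟫ := by rw [inner_sub_right]; linarith
      _ ≤ ‖w‖ * ‖x' - x‖ := real_inner_le_norm _ _
      _ ≤ 1 / γ * ‖x' - x‖ := by gcongr
      _ = ‖x' - x‖ / γ := one_div_mul_eq_div _ _
    exact (le_div_iff₀ hγ).mp h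
  refine ⟨separation, ?_⟩
  rintro x x' hlt ⟨w, hw, hx, hx'⟩
  exact (separation w x x' hw hx hx').not_gt hlt
end

section
/- Let (X, 𝒜) be a measurable space, μ a probability measure on X, X₀ ∈ 𝒜 with μ(X₀) > 0, and ĥ, h* : X → {−1, +1} measurable functions, t ∈ {−1, +1} with h*(x) ≠ t for all x ∈ X₀. Suppose ε_clean and ε_adv are real numbers with 0 < ε_clean < μ(X₀)/(1 + μ(X₀)) and 0 < ε_adv < μ(X₀)/(1 + μ(X₀)), and suppose μ({x ∈ X₀ : ĥ(x) = t}) ≥ (1 − ε_adv)·μ(X₀). Then μ({x ∈ X : ĥ(x) ≠ h*(x)}) > ε_clean. -/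
open MeasureTheory

/-- If the patched region `X₀` (whose true labels all differ from the target
label `t`) has positive measure, then any classifier `ĥ` that assigns label `t`
to at least a `1 - ε_adv` fraction of `X₀` must have clean error exceeding
`ε_clean`. -/
theorem positive_measure_backdoor_forces_clean_error
    {X : Type*} [MeasurableSpace X] (μ : Measure X) [IsProbabilityMeasure μ]
    (X₀ : Set X) (hX₀ : MeasurableSet X₀) (hX₀pos : 0 < μ X₀)
    (hhat hstar : X → ℝ) (hhat_meas : Measurable hhat) (hstar_meas : Measurable hstar)
    (hhat_val : ∀ x, hhat x = 1 ∨ hhat x = -1)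
    (hstar_val : ∀ x, hstar x = 1 ∨ hstar x = -1)
    (t : ℝ) (ht : t = 1 ∨ t = -1)
    (hstar_ne : ∀ x ∈ X₀, hstar x ≠ t)
    (εclean εadv : ℝ)
    (hεclean : 0 < εclean ∧ ENNReal.ofReal εclean < μ X₀ / (1 + μ X₀))
    (hεadv : 0 < εadv ∧ ENNReal.ofReal εadv < μ X₀ / (1 + μ X₀))
    (hsuccess : μ {x ∈ X₀ | hhat x = t} ≥ ENNReal.ofReal (1 - εadv) * μ X₀) :
    μ {x | hhat x ≠ hstar x} > ENNReal.ofReal εclean := by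
  have hsub : {x ∈ X₀ | hhat x = t} ⊆ {x | hhat x ≠ hstar x} := fun x hx h =>
    hstar_ne x hx.1 (h ▸ hx.2)
  refine lt_of_lt_of_le ?_ (hsuccess.trans (measure_mono hsub))
  obtain ⟨m, hm, hμ⟩ : ∃ m : ℝ, 0 < m ∧ μ X₀ = ENNReal.ofReal m :=
    ⟨(μ X₀).toReal, ENNReal.toReal_pos hX₀pos.ne' (measure_ne_top μ X₀),
      (ENNReal.ofReal_toReal (measure_ne_top μ X₀)).symm⟩
  have hquot : μ X₀ / (1 + μ X₀) = ENNReal.ofReal (m / (1 + m)) := by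
    rw [hμ, ENNReal.ofReal_div_of_pos (by positivity), ENNReal.ofReal_add zero_le_one hm.le,
      ENNReal.ofReal_one]
  have hpos : 0 < m / (1 + m) := by positivity
  rw [hquot, ENNReal.ofReal_lt_ofReal_iff hpos] at hεclean hεadv
  have hfix : (1 - m / (1 + m)) * m = m / (1 + m) := by
    field_simp
    ring
  have hgap : m / (1 + m) < (1 - εadv) * m := by
    rw [← hfix]
    gcongr
    exact hεadv.2
  rw [hμ, ← ENNReal.ofReal_mul' hm.le, ENNReal.ofReal_lt_ofReal_iff (hpos.trans hgap)]
  exact hεclean.2.trans hgap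
end

section
/- Let E be a real inner product space, P ⊆ E a linear subspace, w* ∈ E, and v_1, …, v_k an orthonormal family in E such that ⟨v_i, x⟩ = 0 for all x ∈ P and all i, and ⟨w*, v_i⟩ = 0 for all i. Let η_1, …, η_k be positive reals, t ∈ {−1, +1}^k, and R, γ > 0. Define ŵ := w* + (2R/γ)·Σ_{i=1}^k t_i·(1/η_i)·v_i. Then: (a) for every x ∈ P, sign(⟨ŵ, x⟩) = sign(⟨w*, x⟩); and (b) for every j ∈ {1,…,k} and every x ∈ P with |⟨w*, x⟩| ≤ R/γ, sign(⟨ŵ, x + η_j·v_j⟩) = t_j. -/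
open RealInnerProductSpace

/-- Overparameterized linear classifiers can memorize `k` labels: the weight
vector `ŵ` agrees in sign with `w*` on the data subspace `P` while assigning each
target label `t j` to the translated copy `x + η j • v j` of the bounded support. -/
theorem overparameterized_linear_memorization
    {E : Type*} [NormedAddCommGroup E] [InnerProductSpace ℝ E]
    (P : Submodule ℝ E) (wstar : E) (k : ℕ)
    (v : Fin k → E) (hv : Orthonormal ℝ v)
    (hvP : ∀ i, ∀ x ∈ P, ⟪v i, x⟫ = 0)
    (hvw : ∀ i, ⟪wstar, v i⟫ = 0)
    (η : Fin k → ℝ) (hη : ∀ i, 0 < η i)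
    (t : Fin k → ℝ) (ht : ∀ i, t i = 1 ∨ t i = -1)
    (R γ : ℝ) (hR : 0 < R) (hγ : 0 < γ)
    (what : E)
    (hwhat : what = wstar + (2 * R / γ) • ∑ i, (t i * (η i)⁻¹) • v i) :
    (∀ x ∈ P, sgn ⟪what, x⟫ = sgn ⟪wstar, x⟫) ∧
    (∀ j : Fin k, ∀ x ∈ P, |⟪wstar, x⟫| ≤ R / γ →
      sgn ⟪what, x + η j • v j⟫ = t j) := by
  have hP : ∀ x ∈ P, ⟪what, x⟫ = ⟪wstar, x⟫ := fun x hx => by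
    simp [hwhat, inner_add_left, real_inner_smul_left, sum_inner, hvP _ x hx]
  refine ⟨fun x hx => by rw [hP x hx], fun j x hx hxR => ?_⟩
  have hvj : ⟪what, v j⟫ = 2 * R / γ * (t j * (η j)⁻¹) := by
    rw [hwhat, inner_add_left, hvw, zero_add, real_inner_smul_left, hv.inner_left_fintype]
    simp
  have hsum : ⟪what, x + η j • v j⟫ = ⟪wstar, x⟫ + 2 * (R / γ) * t j := by
    have hηj := (hη j).ne'
    rw [inner_add_right, hP x hx, real_inner_smul_right, hvj]
    field_simp
  have hRγ : 0 < R / γ := div_pos hR hγ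
  obtain ⟨hlo, hhi⟩ := abs_le.mp hxR
  rw [hsum, sgn]
  rcases ht j with h | h <;> rw [h]
  · exact if_pos (by linarith)
  · exact if_neg (by linarith)
end

section
/- Let K ⊆ ℝ^d be a convex set and μ a probability measure on ℝ^d with μ(K) = 1 such that every closed ball of positive radius contained in K has positive μ-measure. Let K' ⊆ K be a measurable set with μ(K') = 1. Then the interior of K is contained in the convex hull of K'. -/
open MeasureTheory Metric

/-- In finite dimension, the interior of the closure of a set lies in its convex hull. -/
theorem interior_closure_subset_convexHull {E : Type*} [NormedAddCommGroup E] [NormedSpace ℝ E]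
    [FiniteDimensional ℝ E] (s : Set E) : interior (closure s) ⊆ convexHull ℝ s := by
  intro x hx
  have hspan : affineSpan ℝ s = ⊤ := by
    have hclosed : IsClosed (affineSpan ℝ s : Set E) :=
      AffineSubspace.closed_of_finiteDimensional _
    have hle : affineSpan ℝ (closure s) ≤ affineSpan ℝ s :=
      affineSpan_le.2 (closure_minimal (subset_affineSpan ℝ s) hclosed)
    have htop : affineSpan ℝ (closure s) = ⊤ :=
      affineSpan_eq_top_of_nonempty_interior
        ⟨x, interior_mono (subset_convexHull ℝ (closure s)) hx⟩
    exact top_le_iff.1 (htop ▸ hle)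
  have hne : (interior (convexHull ℝ s)).Nonempty :=
    interior_convexHull_nonempty_iff_affineSpan_eq_top.2 hspan
  have hx' : x ∈ interior (closure (convexHull ℝ s)) :=
    interior_mono (closure_mono (subset_convexHull ℝ s)) hx
  rw [(convex_convexHull ℝ s).interior_closure_eq_interior_of_nonempty_interior hne] at hx'
  exact interior_subset hx'

/-- A full-measure set is dense in the interior of any set all of whose closed balls of positive
radius have positive measure. -/
theorem interior_subset_closure_of_ae_mem {X : Type*} [PseudoMetricSpace X] [MeasurableSpace X]
    {μ : Measure X} {K s : Set X}
    (hballs : ∀ (x : X) (r : ℝ), 0 < r → closedBall x r ⊆ K → 0 < μ (closedBall x r))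
    (hs : ∀ᵐ x ∂μ, x ∈ s) : interior K ⊆ closure s := by
  intro x hx
  refine Metric.mem_closure_iff.2 fun ε hε => ?_
  obtain ⟨δ, hδ, hball⟩ := Metric.nhds_basis_closedBall.mem_iff.1 (mem_interior_iff_mem_nhds.1 hx)
  have hpos : 0 < μ (closedBall x (min δ (ε / 2))) :=
    hballs x _ (lt_min hδ (half_pos hε)) ((closedBall_subset_closedBall (min_le_left _ _)).trans hball)
  obtain ⟨y, hy, hys⟩ := ((frequently_ae_mem_iff.2 hpos.ne').and_eventually hs).exists
  refine ⟨y, hys, ?_⟩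
  have hyx := (mem_closedBall'.1 hy).trans (min_le_right _ _)
  linarith

/-- Any full-measure subset of a convex body, under a measure assigning positive
mass to every closed ball of positive radius contained in the body, has convex
hull covering the body's entire interior. -/
theorem interior_subset_convexHull_of_full_measure
    {d : ℕ} (K : Set (EuclideanSpace ℝ (Fin d))) (hK : Convex ℝ K)
    (μ : Measure (EuclideanSpace ℝ (Fin d))) [IsProbabilityMeasure μ]
    (hKfull : μ K = 1)
    (hballs : ∀ (x : EuclideanSpace ℝ (Fin d)) (r : ℝ), 0 < r →
      closedBall x r ⊆ K → 0 < μ (closedBall x r))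
    (K' : Set (EuclideanSpace ℝ (Fin d))) (hK'meas : MeasurableSet K')
    (hK'sub : K' ⊆ K) (hK'full : μ K' = 1) :
    interior K ⊆ convexHull ℝ K' := by
  have hae : ∀ᵐ x ∂μ, x ∈ K' := (prob_compl_eq_zero_iff hK'meas).2 hK'full
  exact (interior_maximal (interior_subset_closure_of_ae_mem hballs hae) isOpen_interior).trans
    (interior_closure_subset_convexHull K')
end

section
/- Let X' ⊆ ℝ^d be a compact convex set with nonempty interior, let w* ∈ ℝ^d be nonzero, and let X := X' \ {x : ⟨w*, x⟩ = 0}. Let μ be a probability measure on ℝ^d with μ(X) = 1 such that for every measurable Y ⊆ X, μ(Y) = 0 if and only if Y has Lebesgue measure 0 (in particular, every closed ball of positive radius contained in X has positive μ-measure). If ŵ ∈ ℝ^d satisfies ⟨ŵ, x⟩·⟨w*, x⟩ ≥ 0 for μ-almost every x, then ⟨ŵ, x⟩·⟨w*, x⟩ ≥ 0 for every x ∈ X. -/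
open MeasureTheory RealInnerProductSpace

/-- Linear classifiers over convex bodies have zero memorization capacity: on a
compact convex body with the true separating hyperplane removed, any halfspace
`ŵ` agreeing in sign with `w*` almost everywhere agrees in sign everywhere. -/
theorem halfspace_ae_agreement_implies_everywhere
    {d : ℕ} (X' : Set (EuclideanSpace ℝ (Fin d)))
    (hX'cpt : IsCompact X') (hX'cvx : Convex ℝ X')
    (hX'int : (interior X').Nonempty)
    (wstar : EuclideanSpace ℝ (Fin d)) (hwstar : wstar ≠ 0)
    (X : Set (EuclideanSpace ℝ (Fin d)))
    (hX : X = X' \ {x | ⟪wstar, x⟫ = 0})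
    (μ : Measure (EuclideanSpace ℝ (Fin d))) [IsProbabilityMeasure μ]
    (hXfull : μ X = 1)
    (hnull : ∀ Y : Set (EuclideanSpace ℝ (Fin d)), Y ⊆ X → MeasurableSet Y →
      (μ Y = 0 ↔ volume Y = 0))
    (what : EuclideanSpace ℝ (Fin d))
    (hae : ∀ᵐ x ∂μ, 0 ≤ ⟪what, x⟫ * ⟪wstar, x⟫) :
    ∀ x ∈ X, 0 ≤ ⟪what, x⟫ * ⟪wstar, x⟫ := by
  intro x hx
  subst hX
  by_contra! hneg
  let U : Set (EuclideanSpace ℝ (Fin d)) := {y | ⟪what, y⟫ * ⟪wstar, y⟫ < 0}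
  have hU : IsOpen U := isOpen_lt (by fun_prop) continuous_const
  have hcl : x ∈ closure (interior X') := by
    rw [hX'cvx.closure_interior_eq_closure_of_nonempty_interior hX'int]
    exact subset_closure hx.1
  have hne : (U ∩ interior X').Nonempty := mem_closure_iff.1 hcl U hU hneg
  have hopen : IsOpen (U ∩ interior X') := hU.inter isOpen_interior
  have hsub : U ∩ interior X' ⊆ X' \ {x | ⟪wstar, x⟫ = 0} := fun y hy =>
    ⟨interior_subset hy.2, fun h0 => right_ne_zero_of_mul hy.1.ne h0⟩
  have hμ : μ (U ∩ interior X') = 0 :=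
    measure_mono_null (fun y hy => not_le.2 hy.1) (ae_iff.1 hae)
  exact (hopen.measure_pos volume hne).ne' ((hnull _ hsub hopen.measurableSet).1 hμ)
end
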